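/- Let S_λ be a bounded weighted shift on a directed forest T=(V,p). Then S_λ is subnormal if and only if for every vertex v ∈ V the sequence (‖S_λ^n e_v‖²)_{n≥0} is a Stieltjes moment sequence. -/

import Mathlib

open scoped ENNReal Classical
noncomputable section

universe u

namespace ShiftsPaper

/-- ℓ²(V) over ℂ. -/
abbrev Hs (V : Type u) : Type u := lp (fun _ : V => ℂ) 2

/-- canonical orthonormal basis vector -/
def ev {V : Type u} (v : V) : Hs V := lp.single 2 v 1

/-- A directed forest: a nonempty vertex set together with a parent function `p`
such that any vertex lying on a `p`-cycle is a fixed point of `p`. -/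
def IsDirectedForest {V : Type u} (p : V → V) : Prop :=
  Nonempty V ∧ ∀ n : ℕ, 1 ≤ n → ∀ v : V, p^[n] v = v → p v = v

def rootSet {V : Type u} (p : V → V) : Set V := {v | p v = v}

def children {V : Type u} (p : V → V) (v : V) : Set V := {u | p u = v ∧ u ≠ v}

/-- the set of `k`-th children `Chi^⟨k⟩(v)` -/
def childrenIter {V : Type u} (p : V → V) : ℕ → V → Set V
  | 0, v => {v}
  | k + 1, v => {u | p^[k + 1] u = v ∧ p^[k] u ≠ v}

/-- descendants -/
def des {V : Type u} (p : V → V) (v : V) : Set V := ⋃ n : ℕ, childrenIter p n v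

lemma self_mem_des {V : Type u} (p : V → V) (v : V) : v ∈ des p v :=
  Set.mem_iUnion.2 ⟨0, by simp [childrenIter]⟩

/-- `u` and `v` belong to the same tree (connected component) of the forest -/
def sameTree {V : Type u} (p : V → V) (u v : V) : Prop :=
  ∃ m n : ℕ, p^[m] u = p^[n] v

/-- A directed tree is a connected directed forest. -/
def IsDirectedTree {V : Type u} (p : V → V) : Prop :=
  IsDirectedForest p ∧ ∀ u v : V, sameTree p u v

def Leafless {V : Type u} (p : V → V) : Prop := Function.Surjective p

def LocallyCountable {V : Type u} (p : V → V) : Prop :=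
  ∀ v : V, (children p v).Countable

/-- every non-root vertex has exactly one child -/
def Forkless {V : Type u} (p : V → V) : Prop :=
  ∀ v : V, p v ≠ v → ∃! u : V, u ∈ children p v

/-- a system of weights: vanishing at the roots -/
def WeightSystem {V : Type u} (p : V → V) (lam : V → ℂ) : Prop :=
  ∀ v : V, p v = v → lam v = 0

/-- a proper system of weights: vanishing exactly at the roots -/
def ProperWeights {V : Type u} (p : V → V) (lam : V → ℂ) : Prop :=
  ∀ v : V, lam v = 0 ↔ p v = v

/-- `S` is the (bounded) weighted shift on the forest `(V, p)` with weights `lam`: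
`(S f)(v) = lam v • f (p v)`. -/
def IsWeightedShift {V : Type u} (p : V → V) (lam : V → ℂ)
    (S : Hs V →L[ℂ] Hs V) : Prop :=
  ∀ (f : Hs V) (v : V), (S f : ∀ _ : V, ℂ) v = lam v * (f : ∀ _ : V, ℂ) (p v)

def Hyponormal {E : Type u} [NormedAddCommGroup E] [InnerProductSpace ℂ E]
    [CompleteSpace E] (A : E →L[ℂ] E) : Prop :=
  (ContinuousLinearMap.adjoint A ∘L A - A ∘L ContinuousLinearMap.adjoint A).IsPositive

def PowerHyponormal {E : Type u} [NormedAddCommGroup E] [InnerProductSpace ℂ E]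
    [CompleteSpace E] (A : E →L[ℂ] E) : Prop :=
  ∀ n : ℕ, 1 ≤ n → Hyponormal (A ^ n)

/-- `A` is subnormal: it is the restriction of a bounded normal operator on a larger
Hilbert space to an invariant subspace. -/
def Subnormal {E : Type u} [NormedAddCommGroup E] [InnerProductSpace ℂ E]
    [CompleteSpace E] (A : E →L[ℂ] E) : Prop :=
  ∃ (K : Type u) (_ : NormedAddCommGroup K) (_ : InnerProductSpace ℂ K)
    (_ : CompleteSpace K) (J : E →ₗᵢ[ℂ] K) (N : K →L[ℂ] K),
    IsStarNormal N ∧ ∀ x : E, N (J x) = J (A x)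

/-- `μ` is a representing measure (a positive Borel measure on `[0,∞)`) for the
sequence `a`. -/
def IsRepresentingMeasure (μ : MeasureTheory.Measure ℝ) (a : ℕ → ℝ) : Prop :=
  μ (Set.Iio 0) = 0 ∧
    ∀ n : ℕ, ENNReal.ofReal (a n) = ∫⁻ x : ℝ, ENNReal.ofReal (x ^ n) ∂μ

def IsStieltjesMomentSeq (a : ℕ → ℝ) : Prop :=
  (∀ n, 0 ≤ a n) ∧ ∃ μ : MeasureTheory.Measure ℝ, IsRepresentingMeasure μ a

/-- parent function of the `k`-step backward extension `T⟨k⟩`; the new vertices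
`ω_1, …, ω_k` are encoded as `Sum.inr ⟨0⟩, …, Sum.inr ⟨k-1⟩`. -/
def extParent {V : Type u} (p : V → V) (ω : V) (k : ℕ) :
    V ⊕ Fin k → V ⊕ Fin k
  | Sum.inl v =>
      if v = ω then (if h : 0 < k then Sum.inr ⟨0, h⟩ else Sum.inl ω)
      else Sum.inl (p v)
  | Sum.inr j =>
      if h : (j : ℕ) + 1 < k then Sum.inr ⟨(j : ℕ) + 1, h⟩ else Sum.inr j

/-- weights on `T⟨k⟩`: weight `mu 0 = λ'_{ω_0}` at the old root `ω`, weight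
`mu (j+1) = λ'_{ω_{j+1}}` at `ω_{j+1}` for `j+1 < k`, weight `0` at the new root `ω_k`. -/
def extWeights {V : Type u} (lam : V → ℂ) (ω : V) (k : ℕ) (mu : Fin k → ℂ) :
    V ⊕ Fin k → ℂ
  | Sum.inl v => if v = ω then (if h : 0 < k then mu ⟨0, h⟩ else 0) else lam v
  | Sum.inr j => if h : (j : ℕ) + 1 < k then mu ⟨(j : ℕ) + 1, h⟩ else 0

/-- `S` (the weighted shift with weights `lam` on a tree rooted at `ω`) admits a
subnormal `k`-step backward extension. -/
def AdmitsSubnormalBackExt {V : Type u} (p : V → V) (lam : V → ℂ) (ω : V)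
    (S : Hs V →L[ℂ] Hs V) (k : ℕ) : Prop :=
  Subnormal S ∧
    ∃ mu : Fin k → ℂ, (∀ j, mu j ≠ 0) ∧
      ∃ S' : Hs (V ⊕ Fin k) →L[ℂ] Hs (V ⊕ Fin k),
        IsWeightedShift (extParent p ω k) (extWeights lam ω k mu) S' ∧ Subnormal S'

def AdmitsPowerHypoBackExt {V : Type u} (p : V → V) (lam : V → ℂ) (ω : V)
    (S : Hs V →L[ℂ] Hs V) (k : ℕ) : Prop :=
  PowerHyponormal S ∧
    ∃ mu : Fin k → ℂ, (∀ j, mu j ≠ 0) ∧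
      ∃ S' : Hs (V ⊕ Fin k) →L[ℂ] Hs (V ⊕ Fin k),
        IsWeightedShift (extParent p ω k) (extWeights lam ω k mu) S' ∧
        PowerHyponormal S'

/-- the parent function of the subforest `T|_W`. -/
def restrictParent {V : Type u} (p : V → V) (W : Set V) : W → W :=
  fun v => if h : p ↑v ∈ W then ⟨p ↑v, h⟩ else v

/-- the weights `λ→_u` on the subtree `T_(u→)` of descendants of `u`. -/
def subWeights {V : Type u} (lam : V → ℂ) (u : V) (W : Set V) : W → ℂ :=
  fun v => if (v : V) = u then 0 else lam ↑v

/-- parent function of the rooted sum of the family `{(V j, p j)}` with roots `ω j`;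
the new root is `none`. -/
def rsParent {J : Type u} {V : J → Type u} (p : ∀ j, V j → V j) (ω : ∀ j, V j) :
    Option (Σ j, V j) → Option (Σ j, V j)
  | none => none
  | some ⟨j, v⟩ => if v = ω j then none else some ⟨j, p j v⟩

/-- weights on the rooted sum: `0` at the new root, `θ j` at the old root `ω j`. -/
def rsWeights {J : Type u} {V : J → Type u} (lam : ∀ j, V j → ℂ) (ω : ∀ j, V j)
    (θ : J → ℂ) : Option (Σ j, V j) → ℂ
  | none => 0
  | some ⟨j, v⟩ => if v = ω j then θ j else lam j v

/-- iterated weights `λ^(k)_v`. -/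
def iterWeight {V : Type u} (p : V → V) (lam : V → ℂ) : ℕ → V → ℂ
  | 0, _ => 1
  | k + 1, v => iterWeight p lam k (p v) * lam v

/-- parent function `p^[k]` of the `k`-th power forest `T^k`. -/
def kPowParent {V : Type u} (p : V → V) (k : ℕ) (v : V) : V :=
  if p (p^[k - 1] v) = p^[k - 1] v then v else p^[k] v


open MeasureTheory in
lemma moments_of_normal {K : Type u} [NormedAddCommGroup K] [InnerProductSpace ℂ K]
    [CompleteSpace K] (N : K →L[ℂ] K) (hN : IsStarNormal N) (x : K) :
    IsStieltjesMomentSeq (fun n => ‖(N ^ n) x‖ ^ 2) := by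
  refine ⟨fun n => by positivity, ?_⟩
  set A : K →L[ℂ] K := star N * N with hAdef
  have hA : IsSelfAdjoint A := IsSelfAdjoint.star_mul_self N
  have hA0 : 0 ≤ A := star_mul_self_nonneg N
  have hpow : ∀ n, A ^ n = star (N ^ n) * N ^ n := by
    intro n
    rw [hAdef, (hN.star_comm_self).mul_pow, star_pow]
  have hinner : ∀ n, (inner ℂ ((A ^ n) x) x).re = ‖(N ^ n) x‖ ^ 2 := by
    intro n
    rw [hpow, mul_apply_eq_comp, ContinuousLinearMap.star_eq_adjoint,
      ContinuousLinearMap.adjoint_inner_left]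
    exact inner_self_eq_norm_sq (𝕜 := ℂ) _
  have : CompactSpace (spectrum ℝ A) := isCompact_iff_compactSpace.1
    (ContinuousFunctionalCalculus.isCompact_spectrum A)
  let Λ : CompactlySupportedContinuousMap (spectrum ℝ A) ℝ →ₚ[ℝ] ℝ :=
    PositiveLinearMap.mk₀
      { toFun := fun f => (inner ℂ ((cfcHom (R := ℝ) hA f.toContinuousMap) x) x).re
        map_add' := by
          intro f g
          have : (f + g).toContinuousMap = f.toContinuousMap + g.toContinuousMap := rfl
          rw [this, map_add, add_apply, inner_add_left, Complex.add_re]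
        map_smul' := by
          intro c f
          have : (c • f).toContinuousMap = c • f.toContinuousMap := rfl
          rw [this, map_smul, smul_apply,
            ← Complex.coe_smul, inner_smul_left]
          simp }
      (by
        intro f hf
        have h : 0 ≤ cfcHom (R := ℝ) hA f.toContinuousMap :=
          (cfcHom_nonneg_iff hA).2 hf
        have := ((ContinuousLinearMap.nonneg_iff_isPositive _).1 h).re_inner_nonneg_left x
        simpa using this)
  let ν := RealRMK.rieszMeasure Λ
  have hmom : ∀ n : ℕ, ∫ y : spectrum ℝ A, (y : ℝ) ^ n ∂ν = ‖(N ^ n) x‖ ^ 2 := by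
    intro n
    let f : C(spectrum ℝ A, ℝ) := ((ContinuousMap.id ℝ).restrict (spectrum ℝ A)) ^ n
    have h1 := RealRMK.integral_rieszMeasure Λ ⟨f, HasCompactSupport.of_compactSpace f⟩
    have h2 : cfcHom (R := ℝ) hA f = A ^ n := by
      simp only [f, map_pow, cfcHom_id]
    rw [← hinner, ← h2]
    exact h1
  have hint : ∀ n : ℕ, Integrable (fun y : spectrum ℝ A => (y : ℝ) ^ n) ν := by
    intro n
    exact (by fun_prop : Continuous (fun y : spectrum ℝ A => (y : ℝ) ^ n)).integrable_of_hasCompactSupport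
      (HasCompactSupport.of_compactSpace _)
  have hpos : ∀ y : spectrum ℝ A, (0:ℝ) ≤ y := fun y => spectrum_nonneg_of_nonneg hA0 y.2
  refine ⟨ν.map Subtype.val, ?_, fun n => ?_⟩
  · rw [Measure.map_apply measurable_subtype_coe measurableSet_Iio]
    convert measure_empty (μ := ν)
    ext y
    simpa using hpos y
  · change ENNReal.ofReal (‖(N ^ n) x‖ ^ 2) = _
    rw [lintegral_map (by fun_prop) measurable_subtype_coe, ← hmom n,
      ofReal_integral_eq_lintegral_ofReal (hint n)
        (Filter.Eventually.of_forall fun y => pow_nonneg (hpos y) n)]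

lemma fwd {E : Type u} [NormedAddCommGroup E] [InnerProductSpace ℂ E]
    [CompleteSpace E] (A : E →L[ℂ] E) (h : Subnormal A) (x : E) :
    IsStieltjesMomentSeq (fun n => ‖(A ^ n) x‖ ^ 2) := by
  obtain ⟨K, _, _, _, J, N, hN, hJ⟩ := h
  have : ∀ n, (N ^ n) (J x) = J ((A ^ n) x) := by
    intro n
    induction n with
    | zero => simp
    | succ n ih => rw [pow_succ', pow_succ', mul_apply_eq_comp, ih, hJ]; rfl
  have h2 := moments_of_normal N hN (J x)
  simpa [this] using h2

open ContinuousLinearMap in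
lemma hypo_of_quasi {E : Type u} [NormedAddCommGroup E] [InnerProductSpace ℂ E]
    [CompleteSpace E] (T : E →L[ℂ] E)
    (h : ∀ x, adjoint T (T (T x)) = T (adjoint T (T x))) (x : E) :
    ‖adjoint T x‖ ≤ ‖T x‖ := by
  set L : Submodule ℂ E := (LinearMap.range (T : E →ₗ[ℂ] E)).topologicalClosure with hL
  have hLc : IsClosed (L : Set E) := Submodule.isClosed_topologicalClosure _
  have : CompleteSpace L := hLc.completeSpace_coe
  obtain ⟨y, hy, z, hz, rfl⟩ := L.exists_add_mem_mem_orthogonal x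
  have hDy : ∀ y ∈ L, adjoint T (T y) = T (adjoint T y) := by
    intro y hy
    have hcl : IsClosed {y : E | adjoint T (T y) = T (adjoint T y)} :=
      isClosed_eq (by fun_prop) (by fun_prop)
    refine closure_minimal ?_ hcl hy
    rintro _ ⟨w, rfl⟩
    exact h w
  have hz0 : adjoint T z = 0 := by
    refine ext_inner_left ℂ fun w => ?_
    rw [adjoint_inner_right, inner_zero_right]
    exact (Submodule.mem_orthogonal _ _).1 hz _ (Submodule.le_topologicalClosure _ ⟨w, rfl⟩)
  have h1 : ‖adjoint T y‖ = ‖T y‖ := by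
    have := congrArg (fun w => inner ℂ w y) (hDy y hy)
    simp only [adjoint_inner_left] at this
    rw [← adjoint_inner_right T (adjoint T y) y, inner_self_eq_norm_sq_to_K, inner_self_eq_norm_sq_to_K] at this
    have h3 : ‖T y‖ ^ 2 = ‖adjoint T y‖ ^ 2 := Complex.ofReal_injective (by
      push_cast; exact this)
    exact ((sq_eq_sq₀ (norm_nonneg _) (norm_nonneg _)).1 h3).symm
  have h2 : inner ℂ (T y) (T z) = 0 := by
    rw [← adjoint_inner_left, hDy y hy, ← adjoint_inner_right, hz0, inner_zero_right]
  have h3 : ‖T (y + z)‖ * ‖T (y + z)‖ = ‖T y‖ * ‖T y‖ + ‖T z‖ * ‖T z‖ := by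
    rw [map_add, norm_add_sq_eq_norm_sq_add_norm_sq_of_inner_eq_zero _ _ h2]
  rw [map_add, hz0, add_zero, h1]
  nlinarith [norm_nonneg (T (y+z)), norm_nonneg (T y), norm_nonneg (T z)]

open ContinuousLinearMap in
lemma subnormal_of_quasi {E : Type u} [NormedAddCommGroup E] [InnerProductSpace ℂ E]
    [CompleteSpace E] (T : E →L[ℂ] E)
    (h : ∀ x, adjoint T (T (T x)) = T (adjoint T (T x))) : Subnormal T := by
  set D : E →L[ℂ] E := adjoint T * T - T * adjoint T with hD
  have hDin : ∀ x, inner ℂ (D x) x = ((‖T x‖ ^ 2 - ‖adjoint T x‖ ^ 2 : ℝ) : ℂ) := by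
    intro x
    have e1 : inner ℂ (adjoint T (T x)) x = (‖T x‖ : ℂ) ^ 2 := by
      rw [adjoint_inner_left]; exact inner_self_eq_norm_sq_to_K _
    have e2 : inner ℂ (T (adjoint T x)) x = (‖adjoint T x‖ : ℂ) ^ 2 := by
      rw [← adjoint_inner_right]; exact inner_self_eq_norm_sq_to_K _
    simp only [hD, sub_apply, mul_apply_eq_comp, inner_sub_left, e1, e2]
    push_cast
    rfl
  have hDpos : 0 ≤ D := by
    rw [nonneg_iff_isPositive, isPositive_iff_complex]
    intro x
    rw [hDin]
    have := hypo_of_quasi T h x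
    refine ⟨by rw [RCLike.re_to_complex, Complex.ofReal_re], ?_⟩
    simp only [RCLike.re_to_complex, Complex.ofReal_re]
    nlinarith [norm_nonneg (adjoint T x), norm_nonneg (T x)]
  set C : E →L[ℂ] E := CFC.sqrt D with hC
  have hCC : C * C = D := CFC.sqrt_mul_sqrt_self D hDpos
  have hCs : adjoint C = C := by
    have : IsSelfAdjoint C := (CFC.sqrt_nonneg D).isSelfAdjoint
    exact this
  have hCn : ∀ x, ‖C x‖ ^ 2 = ‖T x‖ ^ 2 - ‖adjoint T x‖ ^ 2 := by
    intro x
    have h1 : inner ℂ (C x) (C x) = inner ℂ (D x) x := by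
      rw [← hCC, mul_apply_eq_comp]
      nth_rewrite 3 [← hCs]
      rw [adjoint_inner_left]
    rw [hDin, inner_self_eq_norm_sq_to_K] at h1
    exact Complex.ofReal_injective (by push_cast; push_cast at h1; exact h1)
  have hDT : ∀ x, D (T x) = 0 := by
    intro x
    simp [hD, h x]
  have hCT : ∀ x, C (T x) = 0 := by
    intro x
    have h1 : inner ℂ (C (T x)) (C (T x)) = inner ℂ (D (T x)) (T x) := by
      rw [← hCC, mul_apply_eq_comp]
      nth_rewrite 3 [← hCs]
      rw [adjoint_inner_left]
    rw [hDT, inner_zero_left] at h1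
    exact inner_self_eq_zero.1 h1
  have horth : ∀ a b, inner ℂ (T a) (C b) = 0 := by
    intro a b
    rw [← hCs, adjoint_inner_right, hCT, inner_zero_left]
  have horth' : ∀ a b, inner ℂ (C a) (T b) = 0 := by
    intro a b
    rw [← inner_conj_symm, horth, map_zero]
  let e := WithLp.prodContinuousLinearEquiv 2 ℂ E E
  let N : WithLp 2 (E × E) →L[ℂ] WithLp 2 (E × E) :=
    (e.symm : E × E →L[ℂ] WithLp 2 (E × E)) ∘L
      ((T ∘L fst ℂ E E + C ∘L snd ℂ E E).prod (adjoint T ∘L snd ℂ E E)) ∘L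
      (e : WithLp 2 (E × E) →L[ℂ] E × E)
  let N' : WithLp 2 (E × E) →L[ℂ] WithLp 2 (E × E) :=
    (e.symm : E × E →L[ℂ] WithLp 2 (E × E)) ∘L
      ((adjoint T ∘L fst ℂ E E).prod (C ∘L fst ℂ E E + T ∘L snd ℂ E E)) ∘L
      (e : WithLp 2 (E × E) →L[ℂ] E × E)
  have hN : ∀ a, N a = WithLp.toLp 2 (T a.fst + C a.snd, adjoint T a.snd) := fun a => rfl
  have hN' : ∀ a, N' a = WithLp.toLp 2 (adjoint T a.fst, C a.fst + T a.snd) := fun a => rfl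
  have hadj : N' = adjoint N := by
    rw [eq_adjoint_iff]
    intro a b
    rw [hN, hN', WithLp.prod_inner_apply, WithLp.prod_inner_apply]
    simp only [inner_add_left, inner_add_right, adjoint_inner_left, adjoint_inner_right]
    have : inner ℂ (C a.fst) b.snd = inner ℂ a.fst (C b.snd) := by
      rw [← adjoint_inner_left, hCs]
    change inner ℂ a.fst (T b.fst) + (inner ℂ (C a.fst) b.snd + inner ℂ (T a.snd) b.snd) =
      inner ℂ a.fst (T b.fst) + inner ℂ a.fst (C b.snd) + inner ℂ (T a.snd) b.snd
    rw [this]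
    ring
  refine ⟨WithLp 2 (E × E), inferInstance, inferInstance, inferInstance,
    ⟨(e.symm : E × E →L[ℂ] WithLp 2 (E × E)).toLinearMap ∘ₗ LinearMap.inl ℂ E E, ?_⟩, N, ?_, ?_⟩
  · intro x
    have h1 : ‖WithLp.toLp 2 (x, (0:E))‖ ^ 2 = ‖x‖ ^ 2 := by
      rw [WithLp.prod_norm_sq_eq_of_L2]; simp
    exact (sq_eq_sq₀ (norm_nonneg _) (norm_nonneg _)).1 h1
  · rw [isStarNormal_iff_norm_eq_adjoint]
    intro a
    rw [← hadj]
    refine (sq_eq_sq₀ (norm_nonneg _) (norm_nonneg _)).1 ?_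
    rw [hN, hN', WithLp.prod_norm_sq_eq_of_L2, WithLp.prod_norm_sq_eq_of_L2]
    have e1 := norm_add_sq_eq_norm_sq_add_norm_sq_of_inner_eq_zero _ _ (horth a.fst a.snd)
    have e2 := norm_add_sq_eq_norm_sq_add_norm_sq_of_inner_eq_zero _ _ (horth' a.fst a.snd)
    have e3 := hCn a.fst
    have e4 := hCn a.snd
    change ‖T a.fst + C a.snd‖ ^ 2 + ‖adjoint T a.snd‖ ^ 2 =
      ‖adjoint T a.fst‖ ^ 2 + ‖C a.fst + T a.snd‖ ^ 2
    nlinarith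
  · intro x
    change N (WithLp.toLp 2 (x, 0)) = WithLp.toLp 2 (T x, 0)
    rw [hN]
    simp

section WeightedComp
open MeasureTheory

lemma eLpNorm_two_pow {α : Type u} [MeasurableSpace α] {ν : Measure α} (g : α → ℂ) :
    eLpNorm g 2 ν ^ 2 = ∫⁻ a, ‖g a‖ₑ ^ 2 ∂ν := by
  rw [eLpNorm_eq_lintegral_rpow_enorm_toReal two_ne_zero ENNReal.ofNat_ne_top,
    ← ENNReal.rpow_two, ← ENNReal.rpow_mul]
  simp

lemma lp2_norm_sq {α : Type u} [MeasurableSpace α] {ν : Measure α} (g : Lp ℂ 2 ν) :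
    ENNReal.ofReal (‖g‖ ^ 2) = ∫⁻ a, ‖g a‖ₑ ^ 2 ∂ν := by
  rw [ENNReal.ofReal_pow (norm_nonneg _), ofReal_norm, Lp.enorm_def]
  exact eLpNorm_two_pow _

lemma wc_ae {α : Type u} [MeasurableSpace α] {ν : Measure α} {w : α → ℂ} {φ : α → α}
    (hφ : Measurable φ) (hw : Measurable w) (C : ℝ)
    (h : ∀ g : α → ℝ≥0∞, Measurable g →
      ∫⁻ a, ‖w a‖ₑ ^ 2 * g (φ a) ∂ν ≤ ENNReal.ofReal C * ∫⁻ a, g a ∂ν)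
    {g g' : α → ℂ} (hg : g =ᵐ[ν] g') :
    (fun a => w a * g (φ a)) =ᵐ[ν] fun a => w a * g' (φ a) := by
  obtain ⟨s, hs, hsm, hs0⟩ := exists_measurable_superset_of_null (ae_iff.1 hg)
  have h1 := h (s.indicator 1) (measurable_one.indicator hsm)
  rw [lintegral_indicator_one hsm, hs0, mul_zero, nonpos_iff_eq_zero,
    lintegral_eq_zero_iff (by
      exact (hw.enorm.pow_const 2).mul ((measurable_one.indicator hsm).comp hφ))] at h1
  filter_upwards [h1] with a ha
  by_cases hwa : w a = 0
  · simp [hwa]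
  by_cases hmem : φ a ∈ s
  · simp [hmem, hwa] at ha
  · have : g (φ a) = g' (φ a) := by
      by_contra hne
      exact hmem (hs hne)
    rw [this]

lemma wc_memLp {α : Type u} [MeasurableSpace α] {ν : Measure α} {w : α → ℂ} {φ : α → α}
    (hφ : Measurable φ) (hw : Measurable w) (C : ℝ)
    (h : ∀ g : α → ℝ≥0∞, Measurable g →
      ∫⁻ a, ‖w a‖ₑ ^ 2 * g (φ a) ∂ν ≤ ENNReal.ofReal C * ∫⁻ a, g a ∂ν) (g : Lp ℂ 2 ν) :
    MemLp (fun a => w a * g (φ a)) 2 ν := by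
  have hgm : Measurable g := (Lp.stronglyMeasurable g).measurable
  refine ⟨(hw.mul (hgm.comp hφ)).aestronglyMeasurable, ?_⟩
  have h1 : eLpNorm (fun a => w a * g (φ a)) 2 ν ^ 2 < ∞ := by
    have e := eLpNorm_two_pow (ν := ν) (fun a => w a * g (φ a))
    rw [e]
    simp only [enorm_mul, mul_pow]
    refine (h (fun a => ‖g a‖ₑ ^ 2) (hgm.enorm.pow_const 2)).trans_lt ?_
    rw [← lp2_norm_sq]
    exact ENNReal.mul_lt_top ENNReal.ofReal_lt_top ENNReal.ofReal_lt_top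
  exact ENNReal.pow_lt_top_iff.1 h1 |>.resolve_right (by norm_num)

/-- Existence of bounded weighted composition operators on `L²`. -/
lemma wc_exists {α : Type u} [MeasurableSpace α] {ν : Measure α} {w : α → ℂ} {φ : α → α}
    (hφ : Measurable φ) (hw : Measurable w) (C : ℝ) (hC : 0 ≤ C)
    (h : ∀ g : α → ℝ≥0∞, Measurable g →
      ∫⁻ a, ‖w a‖ₑ ^ 2 * g (φ a) ∂ν ≤ ENNReal.ofReal C * ∫⁻ a, g a ∂ν) :
    ∃ T : Lp ℂ 2 ν →L[ℂ] Lp ℂ 2 ν, ∀ g, T g =ᵐ[ν] fun a => w a * g (φ a) := by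
  let T0 : Lp ℂ 2 ν →ₗ[ℂ] Lp ℂ 2 ν :=
    { toFun := fun g => (wc_memLp hφ hw C h g).toLp _
      map_add' := by
        intro f g
        rw [← MemLp.toLp_add]
        refine MemLp.toLp_congr _ _ ?_
        refine (wc_ae hφ hw C h (Lp.coeFn_add f g)).trans (Filter.Eventually.of_forall fun a => ?_)
        simp [mul_add]
      map_smul' := by
        intro c g
        rw [RingHom.id_apply, ← MemLp.toLp_const_smul]
        refine MemLp.toLp_congr _ _ ?_
        refine (wc_ae hφ hw C h (Lp.coeFn_smul c g)).trans (Filter.Eventually.of_forall fun a => ?_)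
        simp only [Pi.smul_apply, smul_eq_mul]
        ring }
  have hT0 : ∀ g, T0 g =ᵐ[ν] fun a => w a * g (φ a) := fun g => MemLp.coeFn_toLp (wc_memLp hφ hw C h g)
  refine ⟨T0.mkContinuous (Real.sqrt C) fun g => ?_, hT0⟩
  have hgm : Measurable g := (Lp.stronglyMeasurable g).measurable
  have h1 : ENNReal.ofReal (‖T0 g‖ ^ 2) ≤ ENNReal.ofReal (C * ‖g‖ ^ 2) := by
    rw [lp2_norm_sq, ENNReal.ofReal_mul hC, lp2_norm_sq]
    refine le_trans (le_of_eq ?_) (h (fun a => ‖g a‖ₑ ^ 2) (hgm.enorm.pow_const 2))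
    refine lintegral_congr_ae ?_
    filter_upwards [hT0 g] with a ha
    rw [ha, enorm_mul, mul_pow]
  have h2 : ‖T0 g‖ ^ 2 ≤ C * ‖g‖ ^ 2 := (ENNReal.ofReal_le_ofReal_iff (by positivity)).1 h1
  refine abs_le_of_sq_le_sq' ?_ (by positivity) |>.2
  rw [mul_pow, Real.sq_sqrt hC]
  exact h2

end WeightedComp

section Determinacy
open MeasureTheory

lemma integral_moment (μ : Measure ℝ) (a : ℕ → ℝ) (h0 : ∀ n, 0 ≤ a n)
    (h : IsRepresentingMeasure μ a) (n : ℕ) :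
    Integrable (fun x : ℝ => x ^ n) μ ∧ ∫ x, x ^ n ∂μ = a n := by
  have hpos : ∀ᵐ x ∂μ, (0:ℝ) ≤ x := by
    rw [ae_iff]
    convert h.1 using 2
    ext x; simp
  have hposn : 0 ≤ᵐ[μ] fun x : ℝ => x ^ n := by
    filter_upwards [hpos] with x hx using pow_nonneg hx n
  have hm : AEStronglyMeasurable (fun x : ℝ => x ^ n) μ :=
    (continuous_pow n).aestronglyMeasurable
  constructor
  · rw [← lintegral_ofReal_ne_top_iff_integrable hm hposn, ← h.2 n]
    exact ENNReal.ofReal_ne_top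
  · rw [integral_eq_lintegral_of_nonneg_ae hposn hm, ← h.2 n, ENNReal.toReal_ofReal (h0 n)]

lemma supp_of_moment (μ : Measure ℝ) (a : ℕ → ℝ) 
    (h : IsRepresentingMeasure μ a) (R : ℝ) (hR : 0 ≤ R) (hb : ∀ n, a n ≤ R ^ n) :
    ∀ᵐ x ∂μ, x ∈ Set.Icc 0 R := by
  have hpos : ∀ᵐ x ∂μ, (0:ℝ) ≤ x := by
    rw [ae_iff]
    convert h.1 using 2
    ext x; simp
  have hup : ∀ k : ℕ, ∀ᵐ x ∂μ, x < R + 1 / ((k : ℝ) + 1) := by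
    intro k
    set c := R + 1 / ((k : ℝ) + 1) with hc
    have hcR : R < c := by
      have : (0:ℝ) < 1 / ((k : ℝ) + 1) := by positivity
      linarith
    have hc0 : 0 < c := hR.trans_lt hcR
    have key : ∀ n : ℕ, μ (Set.Ici c) ≤ ENNReal.ofReal ((R / c) ^ n) := by
      intro n
      have h1 : ENNReal.ofReal (c ^ n) * μ (Set.Ici c) ≤ ENNReal.ofReal (R ^ n) := by
        calc ENNReal.ofReal (c ^ n) * μ (Set.Ici c)
            = ∫⁻ x in Set.Ici c, ENNReal.ofReal (c ^ n) ∂μ := by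
              rw [setLIntegral_const]
          _ ≤ ∫⁻ x in Set.Ici c, ENNReal.ofReal (x ^ n) ∂μ := by
              refine setLIntegral_mono (by fun_prop) fun x hx => ?_
              exact ENNReal.ofReal_le_ofReal (pow_le_pow_left₀ hc0.le hx n)
          _ ≤ ∫⁻ x, ENNReal.ofReal (x ^ n) ∂μ := setLIntegral_le_lintegral _ _
          _ = ENNReal.ofReal (a n) := (h.2 n).symm
          _ ≤ ENNReal.ofReal (R ^ n) := ENNReal.ofReal_le_ofReal (hb n)
      rw [div_pow, ENNReal.ofReal_div_of_pos (by positivity)]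
      rw [ENNReal.le_div_iff_mul_le (Or.inl (by simp; positivity)) (Or.inl ENNReal.ofReal_ne_top),
        mul_comm]
      exact h1
    have hlim : Filter.Tendsto (fun n : ℕ => ENNReal.ofReal ((R / c) ^ n)) Filter.atTop
        (nhds 0) := by
      rw [← ENNReal.ofReal_zero]
      refine ENNReal.tendsto_ofReal (tendsto_pow_atTop_nhds_zero_of_lt_one (by positivity) ?_)
      rwa [div_lt_one hc0]
    have h0 : μ (Set.Ici c) = 0 := nonpos_iff_eq_zero.1 (ge_of_tendsto' hlim key)
    rw [ae_iff]
    convert h0 using 2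
    ext x; simp
  filter_upwards [hpos, ae_all_iff.2 hup] with x hx hx2
  refine ⟨hx, ?_⟩
  refine le_of_forall_pos_le_add fun ε hε => ?_
  obtain ⟨k, hk⟩ := exists_nat_one_div_lt hε
  linarith [hx2 k]

lemma moment_unique (μ ν : Measure ℝ) (a : ℕ → ℝ) (h0 : ∀ n, 0 ≤ a n)
    (hμ : IsRepresentingMeasure μ a) (hν : IsRepresentingMeasure ν a) (R : ℝ)
    (hμR : ∀ᵐ x ∂μ, x ∈ Set.Icc 0 R) (hνR : ∀ᵐ x ∂ν, x ∈ Set.Icc 0 R) : μ = ν := by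
  have fin : ∀ ρ : Measure ℝ, IsRepresentingMeasure ρ a → IsFiniteMeasure ρ := by
    intro ρ h
    refine ⟨?_⟩
    have := h.2 0
    simp at this
    rw [← this]
    exact ENNReal.ofReal_lt_top
  have fμ := fin μ hμ
  have fν := fin ν hν
  refine ext_of_forall_integral_eq_of_IsFiniteMeasure fun f => ?_
  have hpoly : ∀ ρ : Measure ℝ, IsRepresentingMeasure ρ a → ∀ P : Polynomial ℝ,
      Integrable (fun x => P.eval x) ρ ∧
      ∫ x, P.eval x ∂ρ = ∑ i ∈ Finset.range (P.natDegree + 1), P.coeff i * a i := by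
    intro ρ h P
    simp only [Polynomial.eval_eq_sum_range]
    have hi : ∀ i ∈ Finset.range (P.natDegree + 1),
        Integrable (fun x : ℝ => P.coeff i * x ^ i) ρ :=
      fun i _ => (integral_moment ρ a h0 h i).1.const_mul _
    refine ⟨integrable_finsetSum _ hi, ?_⟩
    rw [integral_finsetSum _ hi]
    refine Finset.sum_congr rfl fun i _ => ?_
    rw [integral_const_mul, (integral_moment ρ a h0 h i).2]
  have happ : ∀ ρ : Measure ℝ, IsRepresentingMeasure ρ a → (∀ᵐ x ∂ρ, x ∈ Set.Icc 0 R) →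
      ∀ P : Polynomial ℝ, ∀ ε : ℝ, (∀ x ∈ Set.Icc 0 R, |P.eval x - f x| < ε) →
      |∫ x, P.eval x ∂ρ - ∫ x, f x ∂ρ| ≤ ε * a 0 := by
    intro ρ h hR P ε hP
    have fρ := fin ρ h
    rw [← integral_sub (hpoly ρ h P).1 (f.integrable ρ)]
    have := norm_integral_le_of_norm_le_const (μ := ρ) (f := fun x => P.eval x - f x) (C := ε) (by
      filter_upwards [hR] with x hx using (hP x hx).le)
    have hm : ρ.real Set.univ = a 0 := by
      have := h.2 0
      simp at this
      rw [Measure.real, ← this, ENNReal.toReal_ofReal (h0 0)]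
    rw [hm] at this
    exact this
  refine eq_of_forall_dist_le fun ε hε => ?_
  rw [Real.dist_eq]
  set δ := ε / (2 * (a 0 + 1)) with hδ
  have ha0 := h0 0
  have hδ0 : 0 < δ := by positivity
  obtain ⟨P, hP⟩ := exists_polynomial_near_of_continuousOn 0 R f f.continuous.continuousOn δ hδ0
  have h1 := happ μ hμ hμR P δ hP
  have h2 := happ ν hν hνR P δ hP
  rw [(hpoly μ hμ P).2] at h1
  rw [(hpoly ν hν P).2] at h2
  have h3 : δ * a 0 ≤ ε / 2 := by
    have : δ * (a 0 + 1) = ε / 2 := by rw [hδ]; field_simp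
    nlinarith
  rw [abs_le] at *
  constructor <;> linarith [h1.1, h1.2, h2.1, h2.2]

end Determinacy

section Assembly
open MeasureTheory

lemma hs_norm_sq {V : Type u} (f : Hs V) :
    ENNReal.ofReal (‖f‖ ^ 2) = ∑' v, ‖(f : ∀ _ : V, ℂ) v‖ₑ ^ 2 := by
  have h1 := lp.norm_rpow_eq_tsum (p := 2) (by norm_num) f
  have h2 := lp.hasSum_norm (p := 2) (by norm_num) f
  simp only [ENNReal.toReal_ofNat, Real.rpow_two] at h1 h2
  rw [h1, ENNReal.ofReal_tsum_of_nonneg (fun v => by positivity) h2.summable]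
  refine tsum_congr fun v => ?_
  rw [ENNReal.ofReal_pow (norm_nonneg _), ofReal_norm]

lemma shift_pow {V : Type u} {p : V → V} {lam : V → ℂ}
    {S : Hs V →L[ℂ] Hs V} (hS : IsWeightedShift p lam S) (n : ℕ) :
    ∃ c : V → ℂ, ∀ (f : Hs V) (w : V),
      ((S ^ n) f : ∀ _ : V, ℂ) w = c w * (f : ∀ _ : V, ℂ) (p^[n] w) := by
  induction n with
  | zero => exact ⟨fun _ => 1, fun f w => by simp⟩
  | succ n ih =>
    obtain ⟨c, hc⟩ := ih
    refine ⟨fun w => lam w * c (p w), fun f w => ?_⟩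
    rw [pow_succ', mul_apply_eq_comp, hS, hc, mul_assoc, Function.iterate_succ_apply]

lemma ev_apply {V : Type u} (u w : V) :
    (ev u : ∀ _ : V, ℂ) w = if w = u then 1 else 0 := by
  rw [ev, lp.single_apply]
  simp [Pi.single_apply]

lemma ev_norm {V : Type u} (u : V) : ‖ev u‖ = 1 := by
  rw [ev, lp.norm_single (by norm_num)]
  simp

lemma shift_norm {V : Type u} {p : V → V} {lam : V → ℂ}
    {S : Hs V →L[ℂ] Hs V} (hS : IsWeightedShift p lam S) (n : ℕ) (f : Hs V) :
    ENNReal.ofReal (‖(S ^ n) f‖ ^ 2) =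
      ∑' u, ‖(f : ∀ _ : V, ℂ) u‖ₑ ^ 2 * ENNReal.ofReal (‖(S ^ n) (ev u)‖ ^ 2) := by
  obtain ⟨c, hc⟩ := shift_pow hS n
  simp only [hs_norm_sq, hc, enorm_mul, mul_pow, ← ENNReal.tsum_mul_left]
  rw [ENNReal.tsum_comm]
  refine tsum_congr fun w => ?_
  rw [tsum_eq_single (p^[n] w)]
  · simp [ev_apply, mul_comm]
  · intro u hu
    simp [ev_apply, hu.symm]

lemma shift_rec {V : Type u} {p : V → V} {lam : V → ℂ}
    {S : Hs V →L[ℂ] Hs V} (hS : IsWeightedShift p lam S) (n : ℕ) (v : V) :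
    ENNReal.ofReal (‖(S ^ (n + 1)) (ev v)‖ ^ 2) =
      ∑' u, (‖lam u‖ₑ ^ 2 * (if p u = v then 1 else 0)) *
        ENNReal.ofReal (‖(S ^ n) (ev u)‖ ^ 2) := by
  rw [pow_succ S n, mul_apply_eq_comp, shift_norm hS]
  refine tsum_congr fun u => ?_
  rw [hS, ev_apply, enorm_mul, mul_pow]
  split_ifs <;> simp

lemma measure_rec {V : Type u} {p : V → V} {lam : V → ℂ}
    {S : Hs V →L[ℂ] Hs V} (hS : IsWeightedShift p lam S) (μ : V → Measure ℝ)
    (hμ : ∀ v, IsRepresentingMeasure (μ v) (fun n => ‖(S ^ n) (ev v)‖ ^ 2))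
    (R : ℝ) (hR : ∀ v, ∀ᵐ x ∂(μ v), x ∈ Set.Icc 0 R) (v : V) :
    Measure.sum (fun u => (‖lam u‖ₑ ^ 2 * (if p u = v then 1 else 0)) • μ u) =
      (μ v).withDensity ENNReal.ofReal := by
  refine moment_unique _ _ (fun n => ‖(S ^ (n + 1)) (ev v)‖ ^ 2) (fun n => by positivity)
    ⟨?_, fun n => ?_⟩ ⟨?_, fun n => ?_⟩ R ?_ ?_
  · rw [Measure.sum_apply _ measurableSet_Iio]
    simp only [Measure.smul_apply, (hμ _).1, smul_zero, tsum_zero]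
  · change ENNReal.ofReal (‖(S ^ (n + 1)) (ev v)‖ ^ 2) = _
    rw [lintegral_sum_measure, shift_rec hS]
    refine tsum_congr fun u => ?_
    rw [lintegral_smul_measure, smul_eq_mul, (hμ u).2 n]
  · exact withDensity_absolutelyContinuous _ _ (hμ v).1
  · rw [lintegral_withDensity_eq_lintegral_mul _ (by fun_prop) (by fun_prop)]
    rw [(hμ v).2 (n + 1)]
    refine lintegral_congr_ae ?_
    filter_upwards [hR v] with x hx
    rw [Pi.mul_apply, ← ENNReal.ofReal_mul hx.1, pow_succ']
  · refine (Measure.ae_sum_iff' (p := fun x => x ∈ Set.Icc 0 R) measurableSet_Icc).2 ?_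
    intro u
    exact Measure.ae_smul_measure (hR u) _
  · exact (withDensity_absolutelyContinuous _ _).ae_le (hR v)

lemma bwd {V : Type u} (p : V → V) (lam : V → ℂ)
    (S : Hs V →L[ℂ] Hs V) (hS : IsWeightedShift p lam S)
    (h : ∀ v : V, IsStieltjesMomentSeq (fun n => ‖(S ^ n) (ev v)‖ ^ 2)) : Subnormal S := by
  choose μ hμ using fun v => (h v).2
  set R : ℝ := ‖S‖ ^ 2 with hRdef
  have hR0 : 0 ≤ R := by positivity
  have hR : ∀ v, ∀ᵐ x ∂(μ v), x ∈ Set.Icc 0 R := by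
    intro v
    refine supp_of_moment (μ v) _ (hμ v) R hR0 fun n => ?_
    have h1 : ‖(S ^ n) (ev v)‖ ≤ ‖S‖ ^ n := by
      have h2 := (S ^ n).le_opNorm (ev v)
      rw [ev_norm, mul_one] at h2
      rcases Nat.eq_zero_or_pos n with rfl | hn
      · simp [ev_norm]
      · exact h2.trans (norm_pow_le' S hn)
    rw [hRdef, ← pow_mul, mul_comm, pow_mul]
    exact pow_le_pow_left₀ (norm_nonneg _) h1 2
  have hmass : ∀ v, μ v Set.univ = 1 := by
    intro v
    have := (hμ v).2 0
    simpa [ev_norm] using this.symm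
  have hrec := measure_rec hS μ hμ R hR
  let : MeasurableSpace V := ⊤
  have hVm : ∀ {β : Type} [MeasurableSpace β] (f : V → β), Measurable f := fun f => measurable_from_top
  let ν : Measure (V × ℝ) := Measure.sum fun v => (μ v).map (Prod.mk v)
  have hν : ∀ g : V × ℝ → ℝ≥0∞, Measurable g →
      ∫⁻ z, g z ∂ν = ∑' v, ∫⁻ x, g (v, x) ∂(μ v) := by
    intro g hg
    rw [lintegral_sum_measure]
    refine tsum_congr fun v => ?_
    rw [lintegral_map hg measurable_prodMk_left]
  have hνR : ∀ᵐ z ∂ν, z.2 ∈ Set.Icc 0 R := by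
    have hm : MeasurableSet {z : V × ℝ | z.2 ∈ Set.Icc 0 R} := measurable_snd measurableSet_Icc
    rw [Measure.ae_sum_iff' hm]
    intro v
    rw [ae_map_iff measurable_prodMk_left.aemeasurable hm]
    exact hR v
  have hφ : Measurable fun z : V × ℝ => (p z.1, z.2) :=
    ((measurable_from_top (f := p)).comp measurable_fst).prodMk measurable_snd
  have hlam : Measurable fun z : V × ℝ => lam z.1 := (hVm lam).comp measurable_fst
  have hx : Measurable fun z : V × ℝ => (z.2 : ℂ) := Complex.measurable_ofReal.comp measurable_snd
  have key : ∀ g : V × ℝ → ℝ≥0∞, Measurable g →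
      ∫⁻ z, ‖lam z.1‖ₑ ^ 2 * g (p z.1, z.2) ∂ν = ∫⁻ z, ENNReal.ofReal z.2 * g z ∂ν := by
    intro g hg
    rw [hν (fun z => ‖lam z.1‖ₑ ^ 2 * g (p z.1, z.2))
        ((hlam.enorm.pow_const 2).mul (hg.comp hφ)),
      hν (fun z => ENNReal.ofReal z.2 * g z)
        ((ENNReal.measurable_ofReal.comp measurable_snd).mul hg)]
    have h1 : ∀ v, ∫⁻ x, ENNReal.ofReal x * g (v, x) ∂(μ v) =
        ∑' u, (‖lam u‖ₑ ^ 2 * (if p u = v then 1 else 0)) * ∫⁻ x, g (v, x) ∂(μ u) := by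
      intro v
      have hgv : Measurable fun x => g (v, x) := hg.comp measurable_prodMk_left
      have h2 := lintegral_withDensity_eq_lintegral_mul (μ v) ENNReal.measurable_ofReal hgv
      simp only [Pi.mul_apply] at h2
      rw [← h2, ← hrec v, lintegral_sum_measure]
      simp only [lintegral_smul_measure, smul_eq_mul]
    simp only [h1]
    rw [ENNReal.tsum_comm]
    refine tsum_congr fun u => ?_
    have hgu : Measurable fun x => g (p u, x) := hg.comp measurable_prodMk_left
    rw [tsum_eq_single (p u), lintegral_const_mul _ hgu]
    · simp
    · intro v hv
      simp [hv.symm]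
  have bT : ∀ g : V × ℝ → ℝ≥0∞, Measurable g →
      ∫⁻ z, ‖lam z.1‖ₑ ^ 2 * g (p z.1, z.2) ∂ν ≤ ENNReal.ofReal R * ∫⁻ z, g z ∂ν := by
    intro g hg
    rw [key g hg, ← lintegral_const_mul _ hg]
    refine lintegral_mono_ae ?_
    filter_upwards [hνR] with z hz
    gcongr
    exact hz.2
  have bM : ∀ g : V × ℝ → ℝ≥0∞, Measurable g →
      ∫⁻ z, ‖(z.2 : ℂ)‖ₑ ^ 2 * g (id z) ∂ν ≤ ENNReal.ofReal (R ^ 2) * ∫⁻ z, g z ∂ν := by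
    intro g hg
    rw [← lintegral_const_mul _ hg]
    refine lintegral_mono_ae ?_
    filter_upwards [hνR] with z hz
    rw [id, ← ofReal_norm, Complex.norm_real, ENNReal.ofReal_pow hR0, Real.norm_of_nonneg hz.1]
    gcongr
    exact hz.2
  obtain ⟨T, hT⟩ := wc_exists hφ hlam R hR0 bT
  obtain ⟨M, hM⟩ := wc_exists measurable_id hx (R ^ 2) (by positivity) bM
  have hTM : ∀ g, T (M g) = M (T g) := by
    intro g
    refine Lp.ext ?_
    have e1 := wc_ae hφ hlam R bT (hM g)
    filter_upwards [hT (M g), hM (T g), hT g, e1] with z h1 h2 h3 h4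
    rw [h1, h4, h2]
    simp only [id]
    rw [h3]
    ring
  have hin : ∀ g, inner ℂ (M g) g = ((‖T g‖ ^ 2 : ℝ) : ℂ) := by
    intro g
    have hgm : Measurable g := (Lp.stronglyMeasurable g).measurable
    have e1 : ∀ᵐ z ∂ν, inner ℂ (M g z) (g z) = ((z.2 * ‖g z‖ ^ 2 : ℝ) : ℂ) := by
      filter_upwards [hM g] with z h1
      rw [h1, id]
      simp only [RCLike.inner_apply, map_mul, Complex.conj_ofReal]
      push_cast
      rw [← Complex.mul_conj']
      ring
    rw [L2.inner_def, integral_congr_ae e1, integral_complex_ofReal]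
    congr 1
    rw [integral_eq_lintegral_of_nonneg_ae]
    · have e2 : ∀ᵐ z ∂ν, ENNReal.ofReal (z.2 * ‖g z‖ ^ 2) = ENNReal.ofReal z.2 * ‖g z‖ₑ ^ 2 := by
        filter_upwards [hνR] with z hz
        rw [ENNReal.ofReal_mul hz.1, ENNReal.ofReal_pow (norm_nonneg _), ofReal_norm]
      rw [lintegral_congr_ae e2, ← key _ (hgm.enorm.pow_const 2)]
      have e3 : ∀ᵐ z ∂ν, ‖lam z.1‖ₑ ^ 2 * ‖g (p z.1, z.2)‖ₑ ^ 2 = ‖T g z‖ₑ ^ 2 := by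
        filter_upwards [hT g] with z h1
        rw [h1, enorm_mul, mul_pow]
      rw [lintegral_congr_ae e3, ← lp2_norm_sq, ENNReal.toReal_ofReal (by positivity)]
    · filter_upwards [hνR] with z hz
      exact mul_nonneg hz.1 (by positivity)
    · exact (measurable_snd.mul (hgm.norm.pow_const 2)).aestronglyMeasurable
  have hTT : ∀ g, ContinuousLinearMap.adjoint T (T g) = M g := by
    have : ((ContinuousLinearMap.adjoint T ∘L T : Lp ℂ 2 ν →L[ℂ] Lp ℂ 2 ν) :
        Lp ℂ 2 ν →ₗ[ℂ] Lp ℂ 2 ν) = (M : Lp ℂ 2 ν →ₗ[ℂ] Lp ℂ 2 ν) := by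
      rw [← ext_inner_map]
      intro g
      change inner ℂ (ContinuousLinearMap.adjoint T (T g)) g = inner ℂ (M g) g
      rw [hin, ContinuousLinearMap.adjoint_inner_left, inner_self_eq_norm_sq_to_K]
      push_cast
      rfl
    intro g
    exact LinearMap.congr_fun this g
  have hsub : Subnormal T := subnormal_of_quasi T fun g => by
    rw [hTT, hTT, hTM]
  -- the embedding
  have hJn : ∀ f : Hs V, ∫⁻ z, ‖(f : ∀ _ : V, ℂ) z.1‖ₑ ^ 2 ∂ν = ENNReal.ofReal (‖f‖ ^ 2) := by
    intro f
    have hfm : Measurable fun z : V × ℝ => (f : ∀ _ : V, ℂ) z.1 :=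
      (hVm (f : ∀ _ : V, ℂ)).comp measurable_fst
    rw [hν _ (hfm.enorm.pow_const 2), hs_norm_sq]
    refine tsum_congr fun v => ?_
    simp [hmass]
  have hJm : ∀ f : Hs V, MemLp (fun z : V × ℝ => (f : ∀ _ : V, ℂ) z.1) 2 ν := by
    intro f
    have hfm : Measurable fun z : V × ℝ => (f : ∀ _ : V, ℂ) z.1 :=
      (hVm (f : ∀ _ : V, ℂ)).comp measurable_fst
    refine ⟨hfm.aestronglyMeasurable, ?_⟩
    have h1 : eLpNorm (fun z : V × ℝ => (f : ∀ _ : V, ℂ) z.1) 2 ν ^ 2 < ∞ := by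
      rw [eLpNorm_two_pow, hJn]
      exact ENNReal.ofReal_lt_top
    exact ENNReal.pow_lt_top_iff.1 h1 |>.resolve_right (by norm_num)
  let J0 : Hs V →ₗ[ℂ] Lp ℂ 2 ν :=
    { toFun := fun f => (hJm f).toLp _
      map_add' := fun f g => rfl
      map_smul' := fun c f => rfl }
  have hJ0 : ∀ f, J0 f =ᵐ[ν] fun z => (f : ∀ _ : V, ℂ) z.1 :=
    fun f => MemLp.coeFn_toLp (hJm f)
  let J : Hs V →ₗᵢ[ℂ] Lp ℂ 2 ν := ⟨J0, by
    intro f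
    have h1 : ENNReal.ofReal (‖J0 f‖ ^ 2) = ENNReal.ofReal (‖f‖ ^ 2) := by
      rw [lp2_norm_sq, ← hJn]
      refine lintegral_congr_ae ?_
      filter_upwards [hJ0 f] with z hz
      rw [hz]
    have h2 := (ENNReal.ofReal_eq_ofReal_iff (by positivity) (by positivity)).1 h1
    exact (sq_eq_sq₀ (norm_nonneg _) (norm_nonneg _)).1 h2⟩
  have hTJ : ∀ f, T (J f) = J (S f) := by
    intro f
    refine Lp.ext ?_
    have e1 := wc_ae hφ hlam R bT (hJ0 f)
    filter_upwards [hT (J f), e1, hJ0 (S f)] with z h1 h2 h3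
    rw [h1]
    refine h2.trans (Eq.trans ?_ h3.symm)
    rw [hS]
  obtain ⟨K, i1, i2, i3, J', N, hN, hJN⟩ := hsub
  refine ⟨K, i1, i2, i3, J'.comp J, N, hN, fun f => ?_⟩
  change N (J' (J f)) = J' (J (S f))
  rw [hJN, hTJ]

end Assembly

/-- Theorem (sub-shift, Lambert-type characterisation): a bounded weighted shift on a
directed forest is subnormal iff `(‖S^n e_v‖²)_{n≥0}` is a Stieltjes moment sequence
for every vertex `v`. -/
theorem subShift {V : Type u} (p : V → V) (hforest : IsDirectedForest p)
    (lam : V → ℂ) (hw : WeightSystem p lam)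
    (S : Hs V →L[ℂ] Hs V) (hS : IsWeightedShift p lam S) :
    Subnormal S ↔
      ∀ v : V, IsStieltjesMomentSeq (fun n => ‖(S ^ n) (ev v)‖ ^ 2) := by
  exact ⟨fun h v => fwd S h (ev v), fun h => bwd p lam S hS h⟩

end ShiftsPaper
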